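/- For each ℓ, r ≥ 3 there exists a constant c = c(ℓ,r) such that for all m, n ≥ 1, the number of r-uniform hypergraphs on [n] with exactly m hyperedges and no Berge ℓ-cycle satisfies N_m^r(n, C_ℓ^r) ≤ 2^{cm} · N_{[m]}^2(n, C_ℓ)^{r!/2}, where N_{[m]}^2(n, C_ℓ) is the number of graphs on [n] with at most m edges containing no cycle of length ℓ. -/

import Mathlib

/-- `H` contains a Berge `p`-cycle. -/
def IsBergeCycle {V : Type*} (H : Finset (Finset V)) (p : ℕ) : Prop :=
  ∃ (v : ZMod p → V) (e : ZMod p → Finset V),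
    Function.Injective v ∧ Function.Injective e ∧
    (∀ i, e i ∈ H) ∧ (∀ i, v i ∈ e i ∧ v (i + 1) ∈ e i)

/-- `N_m^k(n, C_ℓ^k)`: the number of `k`-uniform hypergraphs on `[n]` with exactly `m`
hyperedges that contain no Berge `ℓ`-cycle. -/
noncomputable def NBerge (k n m ℓ : ℕ) : ℕ :=
  {H : Finset (Finset (Fin n)) | (∀ e ∈ H, e.card = k) ∧ H.card = m ∧ ¬ IsBergeCycle H ℓ}.ncard

/-- `N_{[m]}^k(n, C_ℓ^k)`: the same with at most `m` hyperedges. (For `k = 2` a Berge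
`ℓ`-cycle is just a cycle of length `ℓ`.) -/
noncomputable def NleBerge (k n m ℓ : ℕ) : ℕ :=
  {H : Finset (Finset (Fin n)) | (∀ e ∈ H, e.card = k) ∧ H.card ≤ m ∧ ¬ IsBergeCycle H ℓ}.ncard

/-- Two vertices are joined in the shadow of `H` if some hyperedge contains both. -/
def ShadowRel {V : Type*} (H : Finset (Finset V)) (x y : V) : Prop :=
  ∃ e ∈ H, x ∈ e ∧ y ∈ e

/-- A Berge cycle from sequences indexed by the natural numbers. -/
theorem isBergeCycle_of_nat {V : Type*} {H : Finset (Finset V)} {p : ℕ} (hp : 2 ≤ p)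
    (v : ℕ → V) (e : ℕ → Finset V)
    (hv : ∀ i j, i < j → j < p → v i ≠ v j)
    (he : ∀ i j, i < j → j < p → e i ≠ e j)
    (heH : ∀ i < p, e i ∈ H) (hve : ∀ i < p, v i ∈ e i)
    (hve' : ∀ i, i + 1 < p → v (i + 1) ∈ e i) (hlast : v 0 ∈ e (p - 1)) :
    IsBergeCycle H p := by
  have : NeZero p := ⟨by omega⟩
  have : Fact (1 < p) := ⟨by omega⟩
  have inj {α : Type _} (g : ℕ → α) (hg : ∀ i j, i < j → j < p → g i ≠ g j) :
      Function.Injective (fun i : ZMod p => g i.val) := by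
    intro i j hij
    apply ZMod.val_injective p
    rcases lt_trichotomy i.val j.val with h | h | h
    · exact absurd hij (hg _ _ h (ZMod.val_lt j))
    · exact h
    · exact absurd hij.symm (hg _ _ h (ZMod.val_lt i))
  refine ⟨fun i => v i.val, fun i => e i.val, inj v hv, inj e he,
    fun i => heH _ (ZMod.val_lt i), fun i => ⟨hve _ (ZMod.val_lt i), ?_⟩⟩
  have hi := ZMod.val_lt i
  by_cases h : i.val + 1 < p
  · have h1 : (i + 1).val = i.val + 1 := by
      rw [ZMod.val_add_of_lt] <;> rw [ZMod.val_one p]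
      exact h
    simpa only [h1] using hve' _ h
  · have h0 : i.val = p - 1 := by omega
    have h1 : (i + 1).val = 0 := by
      rw [ZMod.val_add, ZMod.val_one p, h0, Nat.sub_add_cancel (by omega), Nat.mod_self]
    simpa only [h1, h0] using hlast

/-- A Berge path closed up through an additional vertex `u` by the hyperedges `a` and `b`. -/
theorem isBergeCycle_of_path {V : Type*} {H : Finset (Finset V)} {k : ℕ}
    (u : V) (w : ℕ → V) (e : ℕ → Finset V) (a b : Finset V)
    (hw : ∀ i j, i < j → j ≤ k → w i ≠ w j) (huw : ∀ i ≤ k, u ≠ w i)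
    (he : ∀ i j, i < j → j < k → e i ≠ e j)
    (ha : ∀ i < k, a ≠ e i) (hb : ∀ i < k, e i ≠ b) (hab : a ≠ b)
    (heH : ∀ i < k, e i ∈ H) (haH : a ∈ H) (hbH : b ∈ H)
    (hwe : ∀ i < k, w i ∈ e i ∧ w (i + 1) ∈ e i)
    (hua : u ∈ a) (hwa : w 0 ∈ a) (hub : u ∈ b) (hwb : w k ∈ b) :
    IsBergeCycle H (k + 2) := by
  let v' : ℕ → V := fun i => Nat.casesOn i u w
  let e' : ℕ → Finset V := fun i => Nat.casesOn i a (fun j => if j < k then e j else b)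
  have he0 : e' 0 = a := rfl
  have he1 : ∀ i < k, e' (i + 1) = e i := fun i hi => if_pos hi
  have he2 : e' (k + 1) = b := if_neg (lt_irrefl k)
  refine isBergeCycle_of_nat (by omega) v' e' ?_ ?_ ?_ ?_ ?_ ?_
  · rintro (_ | i) (_ | j) hij hj
    · omega
    · exact huw j (by omega)
    · omega
    · exact hw i j (by omega) (by omega)
  · rintro (_ | i) (_ | j) hij hj
    · omega
    · rcases (show j < k ∨ j = k by omega) with h | rfl
      · rw [he0, he1 j h]; exact ha j h
      · rw [he0, he2]; exact hab
    · omega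
    · rcases (show j < k ∨ j = k by omega) with h | rfl
      · rw [he1 i (by omega), he1 j h]; exact he i j (by omega) h
      · rw [he1 i (by omega), he2]; exact hb i (by omega)
  · rintro (_ | i) hi
    · exact haH
    · rcases (show i < k ∨ i = k by omega) with h | rfl
      · rw [he1 i h]; exact heH i h
      · rw [he2]; exact hbH
  · rintro (_ | i) hi
    · exact hua
    · rcases (show i < k ∨ i = k by omega) with h | rfl
      · rw [he1 i h]; exact (hwe i h).1
      · rw [he2]; exact hwb
  · rintro (_ | i) hi
    · exact hwa
    · rw [he1 i (by omega)]; exact (hwe i (by omega)).2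
  · rw [show k + 2 - 1 = k + 1 by omega, he2]; exact hub

/-- A greedily built path: every new vertex avoids all earlier hyperedges, as well as the
sets `f x` attached to the earlier vertices `x`. -/
theorem exists_greedy_path {V : Type*} [DecidableEq V] {H : Finset (Finset V)} {r D : ℕ}
    (hr : ∀ e ∈ H, e.card ≤ r) {W : Finset V} (hW : W.Nonempty)
    (f : V → Finset V) (hfH : ∀ x ∈ W, f x ∈ H)
    (step : ∀ x ∈ W, ∀ F : Finset V, F.card ≤ D → ∃ y ∈ W, y ∉ F ∧ ShadowRel H x y)
    (k : ℕ) (hk : r * (2 * k + 1) ≤ D) :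
    ∃ (w : ℕ → V) (e : ℕ → Finset V) (F : Finset V), F.card ≤ r * (2 * k + 1) ∧
      (∀ i ≤ k, w i ∈ W) ∧ (∀ i < k, e i ∈ H ∧ w i ∈ e i ∧ w (i + 1) ∈ e i) ∧
      (∀ i j, i < j → j ≤ k → w j ∉ f (w i)) ∧
      (∀ i j, i + 1 < j → j ≤ k → w j ∉ e i) ∧
      (∀ i ≤ k, f (w i) ⊆ F) ∧ (∀ i < k, e i ⊆ F) := by
  induction k with
  | zero =>
    obtain ⟨x, hx⟩ := hW
    refine ⟨fun _ => x, fun _ => ∅, f x, by simpa using hr _ (hfH x hx), ?_⟩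
    refine ⟨fun _ _ => hx, ?_, ?_, ?_, fun _ _ => subset_rfl, ?_⟩ <;> intros <;> omega
  | succ k ih =>
    have hk' : r * (2 * k + 1) ≤ D :=
      le_trans (Nat.mul_le_mul_left _ (by omega)) hk
    obtain ⟨w, e, F, hF, hwW, he, hwf, hwe, hfF, heF⟩ := ih hk'
    obtain ⟨y, hyW, hyF, g, hgH, hxg, hyg⟩ := step (w k) (hwW k le_rfl) F (hF.trans hk')
    have hw1 : ∀ i ≤ k, (if i ≤ k then w i else y) = w i := fun i hi => if_pos hi
    have hw2 : (if k + 1 ≤ k then w (k + 1) else y) = y := if_neg (by omega)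
    have he1 : ∀ i < k, (if i < k then e i else g) = e i := fun i hi => if_pos hi
    have he2 : (if k < k then e k else g) = g := if_neg (by omega)
    refine ⟨fun i => if i ≤ k then w i else y, fun i => if i < k then e i else g,
      F ∪ f y ∪ g, ?_, ?_, ?_, ?_, ?_, ?_, ?_⟩
    · have h1 := Finset.card_union_le (F ∪ f y) g
      have h2 := Finset.card_union_le F (f y)
      have h3 := hr _ (hfH y hyW)
      have h4 := hr _ hgH
      nlinarith
    · intro i hi
      rcases (show i ≤ k ∨ i = k + 1 by omega) with h | rfl
      · simpa only [hw1 i h] using hwW i h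
      · simpa only [hw2] using hyW
    · intro i hi
      rcases (show i < k ∨ i = k by omega) with h | rfl
      · simpa only [hw1 i h.le, hw1 (i + 1) h, he1 i h] using he i h
      · simpa only [hw1 i le_rfl, hw2, he2] using ⟨hgH, hxg, hyg⟩
    · intro i j hij hj
      rcases (show j ≤ k ∨ j = k + 1 by omega) with h | rfl
      · simpa only [hw1 i (by omega), hw1 j h] using hwf i j hij h
      · simp only [hw1 i (by omega), hw2]
        exact fun h => hyF (hfF i (by omega) h)
    · intro i j hij hj
      rcases (show j ≤ k ∨ j = k + 1 by omega) with h | rfl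
      · simpa only [he1 i (by omega), hw1 j h] using hwe i j hij h
      · simp only [he1 i (by omega), hw2]
        exact fun h => hyF (heF i (by omega) h)
    · intro i hi
      rcases (show i ≤ k ∨ i = k + 1 by omega) with h | rfl
      · simp only [hw1 i h]
        exact (hfF i h).trans (Finset.subset_union_left.trans Finset.subset_union_left)
      · simp only [hw2]
        exact Finset.subset_union_right.trans Finset.subset_union_left
    · intro i hi
      rcases (show i < k ∨ i = k by omega) with h | rfl
      · simp only [he1 i h]
        exact (heF i h).trans (Finset.subset_union_left.trans Finset.subset_union_left)
      · simp only [he2]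
        exact Finset.subset_union_right

/-- If inside a set `W` of shadow neighbours of `u` one can always step to a new vertex while
avoiding a given small set, then there is a Berge cycle through `u`. -/
theorem isBergeCycle_of_step {V : Type*} [DecidableEq V] {H : Finset (Finset V)} {r k : ℕ}
    (hr : ∀ e ∈ H, e.card ≤ r) {W : Finset V} (hW : W.Nonempty) (u : V) (hu : u ∉ W)
    (huW : ∀ x ∈ W, ShadowRel H u x) (hk : 1 ≤ k)
    (step : ∀ x ∈ W, ∀ F : Finset V, F.card ≤ r * (3 * k + 3) →
      ∃ y ∈ W, y ∉ F ∧ ShadowRel H x y) :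
    IsBergeCycle H (k + 2) := by
  choose! f hfH huf hxf using huW
  obtain ⟨w, e, F, hF, hwW, he, hwf, hwe, hfF, heF⟩ :=
    exists_greedy_path hr hW f hfH step k (Nat.mul_le_mul_left _ (by omega))
  have hww : ∀ i j, i < j → j ≤ k → w i ≠ w j := fun i j hij hj h =>
    hwf i j hij hj (h ▸ hxf _ (hwW i (by omega)))
  have hee : ∀ i j, i < j → j < k → e i ≠ e j := fun i j hij hj h =>
    hwe i (j + 1) (by omega) (by omega) (h ▸ (he j hj).2.2)
  have hfe : ∀ i j, i ≤ j → j < k → f (w i) ≠ e j := fun i j hij hj h =>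
    hwf i (j + 1) (by omega) (by omega) (h ▸ (he j hj).2.2)
  let L : Finset (Finset V) := H.filter fun g => u ∈ g ∧ w k ∈ g
  by_cases hL : k + 2 ≤ L.card
  · let T : Finset (Finset V) := insert (f (w 0)) ((Finset.range k).image e)
    have hT : T.card ≤ k + 1 := by
      refine (Finset.card_insert_le _ _).trans ?_
      have := Finset.card_image_le (s := Finset.range k) (f := e)
      rw [Finset.card_range] at this
      omega
    obtain ⟨b, hbL, hbT⟩ := Finset.exists_mem_notMem_of_card_lt_card (s := T) (t := L) (by omega)
    simp only [L, Finset.mem_filter] at hbL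
    simp only [T, Finset.mem_insert, Finset.mem_image, Finset.mem_range, not_or, not_exists,
      not_and] at hbT
    exact isBergeCycle_of_path u w e (f (w 0)) b hww
      (fun i hi h => hu (h ▸ hwW i hi)) hee (fun i hi => hfe 0 i (by omega) hi)
      (fun i hi => hbT.2 i hi) (Ne.symm hbT.1) (fun i hi => (he i hi).1)
      (hfH _ (hwW 0 (by omega))) hbL.1 (fun i hi => (he i hi).2) (huf _ (hwW 0 (by omega)))
      (hxf _ (hwW 0 (by omega))) hbL.2.1 hbL.2.2
  · have hB : (L.biUnion id).card ≤ (k + 1) * r := by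
      refine (Finset.card_biUnion_le_card_mul L id r ?_).trans (Nat.mul_le_mul_right _ (by omega))
      exact fun g hg => hr g (Finset.mem_filter.1 hg).1
    have hFB : (F ∪ L.biUnion id).card ≤ r * (3 * k + 3) := by
      have := Finset.card_union_le F (L.biUnion id)
      nlinarith
    obtain ⟨y, hyW, hyF, g, hgH, hxg, hyg⟩ := step (w k) (hwW k le_rfl) _ hFB
    rw [Finset.mem_union, not_or] at hyF
    obtain ⟨hyF, hyL⟩ := hyF
    have hyL' : ∀ g ∈ H, u ∈ g → w k ∈ g → y ∉ g := fun g h1 h2 h3 h4 =>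
      hyL (Finset.mem_biUnion.2 ⟨g, Finset.mem_filter.2 ⟨h1, h2, h3⟩, h4⟩)
    have hyf : ∀ i ≤ k, y ∉ f (w i) := fun i hi h => hyF (hfF i hi h)
    have hye : ∀ i < k, y ∉ e i := fun i hi h => hyF (heF i hi h)
    let w' : ℕ → V := fun i => if i < k then w (i + 1) else y
    let e' : ℕ → Finset V := fun i => if i + 1 < k then e (i + 1) else g
    have hw1 : ∀ i < k, w' i = w (i + 1) := fun i hi => if_pos hi
    have hw2 : w' k = y := if_neg (by omega)
    have he1 : ∀ i, i + 1 < k → e' i = e (i + 1) := fun i hi => if_pos hi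
    have he2 : ∀ i, i + 1 = k → e' i = g := fun i hi => if_neg (by omega)
    refine isBergeCycle_of_path u w' e' (f (w 1)) (f y) ?_ ?_ ?_ ?_ ?_ ?_ ?_
      (hfH _ (hwW 1 hk)) (hfH y hyW) ?_ (huf _ (hwW 1 hk)) ?_ (huf _ hyW) ?_
    · intro i j hij hj
      rcases (show j < k ∨ j = k by omega) with h | rfl
      · rw [hw1 i (by omega), hw1 j h]; exact hww _ _ (by omega) (by omega)
      · rw [hw1 i (by omega), hw2]
        exact fun h => hyf (i + 1) (by omega) (h ▸ hxf _ (hwW _ (by omega)))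
    · intro i hi h
      rcases (show i < k ∨ i = k by omega) with h' | rfl
      · rw [hw1 i h'] at h; exact hu (h ▸ hwW _ (by omega))
      · rw [hw2] at h; exact hu (h ▸ hyW)
    · intro i j hij hj
      rcases (show j + 1 < k ∨ j + 1 = k by omega) with h | h
      · rw [he1 i (by omega), he1 j h]; exact hee _ _ (by omega) (by omega)
      · rw [he1 i (by omega), he2 j h]
        exact fun h => hye (i + 1) (by omega) (h ▸ hyg)
    · intro i hi
      rcases (show i + 1 < k ∨ i + 1 = k by omega) with h | h
      · rw [he1 i h]; exact hfe _ _ (by omega) h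
      · rw [he2 i h]; exact fun h => hyf 1 hk (h ▸ hyg)
    · intro i hi
      rcases (show i + 1 < k ∨ i + 1 = k by omega) with h | h
      · rw [he1 i h]; exact fun h' => hye _ h (h' ▸ hxf y hyW)
      · rw [he2 i h]
        exact fun h' => hyL' g hgH (h' ▸ huf y hyW) hxg hyg
    · exact fun h => hyf 1 hk (h ▸ hxf y hyW)
    · intro i hi
      rcases (show i + 1 < k ∨ i + 1 = k by omega) with h | h
      · rw [he1 i h]; exact (he _ h).1
      · rw [he2 i h]; exact hgH
    · intro i hi
      rcases (show i + 1 < k ∨ i + 1 = k by omega) with h | h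
      · rw [he1 i h, hw1 i hi, hw1 (i + 1) h]; exact (he _ h).2
      · rw [he2 i h, hw1 i hi, h, hw2]; exact ⟨hxg, hyg⟩
    · rw [hw1 0 (by omega)]; exact hxf _ (hwW 1 hk)
    · rw [hw2]; exact hxf y hyW

open Classical in
/-- The sets of pairwise related elements of a finite set on which a relation is `D`-degenerate
number at most `2 ^ D` per element, apart from the empty set. -/
theorem card_cliques_le_of_degenerate {V : Type*} (R : V → V → Prop) (D : ℕ)
    (U : Finset V)
    (hU : ∀ W ⊆ U, W.Nonempty → ∃ x ∈ W, (W.filter fun y => y ≠ x ∧ R x y).card ≤ D) :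
    (U.powerset.filter fun S => S.Nonempty ∧ ∀ x ∈ S, ∀ y ∈ S, x ≠ y → R x y).card
      ≤ 2 ^ D * U.card := by
  induction U using Finset.strongInduction with
  | H U ih =>
    rcases U.eq_empty_or_nonempty with rfl | hne
    · simp [Finset.filter_singleton]
    obtain ⟨x, hx, hxD⟩ := hU U subset_rfl hne
    have h1 := ih (U.erase x) (Finset.erase_ssubset hx)
      (fun W hW hWne => hU W (hW.trans (Finset.erase_subset _ _)) hWne)
    let N := U.filter fun y => y ≠ x ∧ R x y
    have h2 : (U.powerset.filter fun S => S.Nonempty ∧ ∀ x ∈ S, ∀ y ∈ S, x ≠ y → R x y) ⊆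
        ((U.erase x).powerset.filter fun S => S.Nonempty ∧ ∀ x ∈ S, ∀ y ∈ S, x ≠ y → R x y) ∪
          N.powerset.image (insert x) := by
      intro S hS
      simp only [Finset.mem_filter, Finset.mem_powerset] at hS
      obtain ⟨hSU, hSne, hSR⟩ := hS
      simp only [Finset.mem_union, Finset.mem_filter, Finset.mem_powerset, Finset.mem_image]
      by_cases hxS : x ∈ S
      · refine Or.inr ⟨S.erase x, ?_, Finset.insert_erase hxS⟩
        intro y hy
        obtain ⟨hyx, hyS⟩ := Finset.mem_erase.1 hy
        exact Finset.mem_filter.2 ⟨hSU hyS, hyx, hSR x hxS y hyS hyx.symm⟩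
      · exact Or.inl ⟨fun y hy => Finset.mem_erase.2 ⟨fun h => hxS (h ▸ hy), hSU hy⟩, hSne, hSR⟩
    have h3 : (N.powerset.image (insert x)).card ≤ 2 ^ D := by
      refine Finset.card_image_le.trans ?_
      rw [Finset.card_powerset]
      exact Nat.pow_le_pow_right (by norm_num) hxD
    have h4 := (Finset.card_le_card h2).trans (Finset.card_union_le _ _)
    have h5 : (U.erase x).card + 1 = U.card := Finset.card_erase_add_one hx
    rw [← h5, Nat.mul_add, Nat.mul_one]
    omega

/-- An `r`-graph without Berge `(k + 2)`-cycles has linearly many `r`-cliques in its shadow. -/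
theorem exists_superset_shadow_cliques {V : Type*} [Fintype V] {H : Finset (Finset V)} {r k : ℕ}
    (hr : ∀ e ∈ H, e.card = r) (hr2 : 2 ≤ r) (hk : 1 ≤ k) (hH : ¬ IsBergeCycle H (k + 2)) :
    ∃ K : Finset (Finset V), K.card ≤ 2 ^ (r * (3 * k + 3)) * (r * r) * H.card ∧
      ∀ S : Finset V, S.card = r → (∀ x ∈ S, ∀ y ∈ S, x ≠ y → ShadowRel H x y) → S ∈ K := by
  classical
  set D := r * (3 * k + 3)
  let N : V → Finset V := fun u => Finset.univ.filter fun x => x ≠ u ∧ ShadowRel H u x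
  let Q : V → Finset (Finset V) := fun u =>
    (N u).powerset.filter fun S => S.Nonempty ∧ ∀ x ∈ S, ∀ y ∈ S, x ≠ y → ShadowRel H x y
  have hQ : ∀ u, (Q u).card ≤ 2 ^ D * (N u).card := by
    intro u
    suffices h : ∀ W ⊆ N u, W.Nonempty →
        ∃ x ∈ W, (W.filter fun y => y ≠ x ∧ ShadowRel H x y).card ≤ D by
      convert card_cliques_le_of_degenerate (ShadowRel H) D (N u) h
    intro W hW hWne
    by_contra! hcon
    refine hH (isBergeCycle_of_step (fun e he => (hr e he).le) hWne u ?_ ?_ hk ?_)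
    · exact fun h => (Finset.mem_filter.1 (hW h)).2.1 rfl
    · exact fun x hx => (Finset.mem_filter.1 (hW hx)).2.2
    · intro x hx F hF
      obtain ⟨y, hy, hyF⟩ := Finset.exists_mem_notMem_of_card_lt_card (hF.trans_lt (hcon x hx))
      obtain ⟨hyW, -, hxy⟩ := Finset.mem_filter.1 hy
      exact ⟨y, hyW, hyF, hxy⟩
  have hN : ∑ u, (N u).card ≤ H.card * (r * r) := by
    have h1 : ∑ u, (N u).card = ((Finset.univ : Finset V).sigma N).card :=
      (Finset.card_sigma _ _).symm
    have h2 : ((Finset.univ : Finset V).sigma N).card ≤ (H.biUnion fun e => e ×ˢ e).card := by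
      refine Finset.card_le_card_of_injOn (fun p => (p.1, p.2)) ?_ ?_
      · rintro ⟨u, x⟩ h
        simp only [Finset.coe_sigma, Set.mem_sigma_iff, N, Finset.mem_coe, Finset.mem_filter] at h
        obtain ⟨-, -, -, e, he, hu, hx⟩ := h
        exact Finset.mem_coe.2
          (Finset.mem_biUnion.2 ⟨e, he, Finset.mem_product.2 ⟨hu, hx⟩⟩)
      · rintro ⟨u, x⟩ - ⟨u', x'⟩ - h
        simpa using h
    rw [h1]
    refine h2.trans (Finset.card_biUnion_le_card_mul _ _ _ fun e he => ?_)
    rw [Finset.card_product, hr e he]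
  refine ⟨Finset.univ.biUnion fun u => (Q u).image (insert u), ?_, fun S hSr hSR => ?_⟩
  · calc _ ≤ ∑ u, ((Q u).image (insert u)).card := Finset.card_biUnion_le
      _ ≤ ∑ u, 2 ^ D * (N u).card :=
          Finset.sum_le_sum fun u _ => Finset.card_image_le.trans (hQ u)
      _ = 2 ^ D * ∑ u, (N u).card := by rw [Finset.mul_sum]
      _ ≤ 2 ^ D * (H.card * (r * r)) := Nat.mul_le_mul_left _ hN
      _ = _ := by ring
  · obtain ⟨u, hu⟩ := Finset.card_pos.1 (by omega : 0 < S.card)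
    refine Finset.mem_biUnion.2 ⟨u, Finset.mem_univ u, Finset.mem_image.2
      ⟨S.erase u, Finset.mem_filter.2 ⟨Finset.mem_powerset.2 fun y hy => ?_, ?_, ?_⟩,
        Finset.insert_erase hu⟩⟩
    · obtain ⟨hyu, hyS⟩ := Finset.mem_erase.1 hy
      exact Finset.mem_filter.2 ⟨Finset.mem_univ y, hyu, hSR u hu y hyS hyu.symm⟩
    · have := Finset.card_erase_add_one hu
      exact Finset.card_pos.1 (by omega)
    · exact fun x hx y hy => hSR x (Finset.mem_of_mem_erase hx) y (Finset.mem_of_mem_erase hy)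

/-- Shrinking every hyperedge creates no new Berge cycle. -/
theorem IsBergeCycle.of_image {V : Type*} [DecidableEq V] {H : Finset (Finset V)} {p : ℕ}
    {g : Finset V → Finset V} (hg : ∀ e ∈ H, g e ⊆ e) (h : IsBergeCycle (H.image g) p) :
    IsBergeCycle H p := by
  obtain ⟨v, e, hv, he, heH, hve⟩ := h
  choose e' he' hge using fun i => Finset.mem_image.1 (heH i)
  refine ⟨v, e', hv, fun i j hij => he ?_, he', fun i => ?_⟩
  · rw [← hge i, ← hge j, hij]
  · have := hge i ▸ hve i
    exact ⟨hg _ (he' i) this.1, hg _ (he' i) this.2⟩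

/-- The pairs inside an `r`-set can be listed with indices in `Fin (r.choose 2)`. -/
theorem exists_enumeration_pairs {V : Type*} (r : ℕ) :
    ∃ φ : Finset V → Fin (r.choose 2) → Finset V, ∀ e : Finset V, e.card = r →
      ∀ s, s ∈ e.powersetCard 2 ↔ ∃ a, φ e a = s := by
  have h : ∀ e : Finset V, ∃ φ : Fin (r.choose 2) → Finset V, e.card = r →
      ∀ s, s ∈ e.powersetCard 2 ↔ ∃ a, φ a = s := by
    intro e
    by_cases he : e.card = r
    · let E := Finset.equivFinOfCardEq (s := e.powersetCard 2) (n := r.choose 2)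
        (by rw [Finset.card_powersetCard, he])
      refine ⟨fun a => E.symm a, fun _ s => ⟨fun hs => ⟨E ⟨s, hs⟩, by simp⟩, ?_⟩⟩
      rintro ⟨a, rfl⟩
      exact (E.symm a).2
    · exact ⟨fun _ => ∅, fun h => absurd h he⟩
  choose φ hφ using h
  exact ⟨φ, hφ⟩

theorem choose_two_le_factorial_div_two {r : ℕ} (hr : 2 ≤ r) :
    r.choose 2 ≤ Nat.factorial r / 2 := by
  rw [Nat.choose_two_right]
  refine Nat.div_le_div_right ?_
  obtain ⟨s, rfl⟩ : ∃ s, r = s + 1 := ⟨r - 1, by omega⟩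
  rw [Nat.factorial_succ, Nat.add_sub_cancel]
  exact Nat.mul_le_mul_left _ (Nat.self_le_factorial s)

theorem one_le_NleBerge (k n m ℓ : ℕ) : 1 ≤ NleBerge k n m ℓ := by
  rw [NleBerge, Nat.one_le_iff_ne_zero, ← Nat.pos_iff_ne_zero, Set.ncard_pos (Set.toFinite _)]
  refine ⟨∅, by simp, by simp, ?_⟩
  rintro ⟨v, e, -, -, h, -⟩
  simpa using h 0

theorem stmt9 (ℓ r : ℕ) (hℓ : 3 ≤ ℓ) (hr : 3 ≤ r) :
    ∃ c : ℕ, ∀ m n : ℕ, 1 ≤ m → 1 ≤ n →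
      NBerge r n m ℓ ≤ 2 ^ (c * m) * NleBerge 2 n m ℓ ^ (Nat.factorial r / 2) := by
  classical
  obtain ⟨k, rfl⟩ : ∃ k, ℓ = k + 2 := ⟨ℓ - 2, by omega⟩
  refine ⟨2 ^ (r * (3 * k + 3)) * (r * r), fun m n _ _ => ?_⟩
  set c := 2 ^ (r * (3 * k + 3)) * (r * r)
  refine le_trans ?_ (Nat.mul_le_mul_left _ (Nat.pow_le_pow_right
    (one_le_NleBerge 2 n m (k + 2)) (choose_two_le_factorial_div_two (by omega : 2 ≤ r))))
  obtain ⟨φ, hφ⟩ := exists_enumeration_pairs (V := Fin n) r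
  let A : Finset (Finset (Finset (Fin n))) := Finset.univ.filter fun H =>
    (∀ e ∈ H, e.card = r) ∧ H.card = m ∧ ¬ IsBergeCycle H (k + 2)
  let B : Finset (Finset (Finset (Fin n))) := Finset.univ.filter fun H =>
    (∀ e ∈ H, e.card = 2) ∧ H.card ≤ m ∧ ¬ IsBergeCycle H (k + 2)
  have hA : NBerge r n m (k + 2) = A.card := by
    rw [NBerge, ← Set.ncard_coe_finset]
    congr 1
    ext H
    simp [A]
  have hB : NleBerge 2 n m (k + 2) = B.card := by
    rw [NleBerge, ← Set.ncard_coe_finset]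
    congr 1
    ext H
    simp [B]
  let Φ : Finset (Finset (Fin n)) → Fin (r.choose 2) → Finset (Finset (Fin n)) :=
    fun H a => H.image fun e => φ e a
  have hmaps : ∀ H ∈ A, Φ H ∈ Fintype.piFinset fun _ : Fin (r.choose 2) => B := by
    intro H hH
    obtain ⟨-, h1, h2, h3⟩ := Finset.mem_filter.1 hH
    have hφ' : ∀ e ∈ H, ∀ a, φ e a ⊆ e ∧ (φ e a).card = 2 := fun e he a =>
      Finset.mem_powersetCard.1 ((hφ e (h1 e he) _).2 ⟨a, rfl⟩)
    refine Fintype.mem_piFinset.2 fun a => Finset.mem_filter.2 ⟨Finset.mem_univ _, ?_, ?_, ?_⟩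
    · intro s hs
      obtain ⟨e, he, rfl⟩ := Finset.mem_image.1 hs
      exact (hφ' e he a).2
    · exact Finset.card_image_le.trans h2.le
    · exact fun h => h3 (h.of_image fun e he => (hφ' e he a).1)
  have hfib : ∀ G ∈ Fintype.piFinset fun _ : Fin (r.choose 2) => B,
      (A.filter fun H => Φ H = G).card ≤ 2 ^ (c * m) := by
    intro G _
    rcases (A.filter fun H => Φ H = G).eq_empty_or_nonempty with h0 | ⟨H₀, hH₀⟩
    · rw [h0]; simp
    obtain ⟨hH₀A, rfl⟩ := Finset.mem_filter.1 hH₀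
    obtain ⟨-, h1, h2, h3⟩ := Finset.mem_filter.1 hH₀A
    obtain ⟨K, hcl, hK⟩ := exists_superset_shadow_cliques h1 (by omega) (by omega) h3
    rw [h2] at hcl
    refine le_trans (Finset.card_le_card (t := K.powerset) ?_)
      ((Finset.card_powerset _).le.trans (Nat.pow_le_pow_right (by norm_num) hcl))
    intro H hH
    obtain ⟨hHA, hΦ⟩ := Finset.mem_filter.1 hH
    obtain ⟨-, h1', -, -⟩ := Finset.mem_filter.1 hHA
    refine Finset.mem_powerset.2 fun S hS => hK S (h1' S hS) fun x hx y hy hxy => ?_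
    obtain ⟨a, ha⟩ := (hφ S (h1' S hS) {x, y}).1 (Finset.mem_powersetCard.2
      ⟨by simp [Finset.insert_subset_iff, hx, hy], Finset.card_pair hxy⟩)
    have hmem : ({x, y} : Finset (Fin n)) ∈ Φ H₀ a := by
      rw [← hΦ]
      exact Finset.mem_image.2 ⟨S, hS, ha⟩
    obtain ⟨e, he, hea⟩ := Finset.mem_image.1 hmem
    have hsub := (Finset.mem_powersetCard.1 ((hφ e (h1 e he) _).2 ⟨a, hea⟩)).1
    exact ⟨e, he, hsub (by simp), hsub (by simp)⟩
  have := Finset.card_le_mul_card_image_of_maps_to hmaps _ hfib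
  rw [hA, hB]
  simpa [Fintype.card_piFinset] using this
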